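/- For all m, n, d ≥ 0 one has #(L_A ⊠ L_B)_{m,n}^d = #(L_A)_m^d · #(L_B)_n^d, where (L_A)_m^d is the (finite) set of words of L_A containing exactly m occurrences of letters from {τ_{1,1},…,τ_{1,a}} and exactly d occurrences of letters from {α_1,…,α_p}, (L_B)_n^d is the set of words of L_B with exactly n occurrences of letters from {τ_{2,1},…,τ_{2,b}} and d occurrences of letters from {β_1,…,β_q}, and (L_A ⊠ L_B)_{m,n}^d is the set of words of L_A ⊠ L_B with exactly m occurrences of letters τ_{1,·}, n occurrences of letters τ_{2,·}, and d occurrences of γ-letters. -/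

import Mathlib

/-!
The alphabet `Σ_A` is `Fin a ⊕ Fin p`: `Sum.inl t` is the letter `τ_{1,t}` and
`Sum.inr i` is the letter `α_i`; similarly `Σ_B = Fin b ⊕ Fin q`.  The Segre alphabet is
`(Fin a ⊕ Fin b) ⊕ (Fin p × Fin q)` with `Sum.inr (i, j)` being the letter `γ_{i,j}`.
-/

/-- The Segre product of two languages. -/
def segreLang {a p b q : ℕ} (LA : Language (Fin a ⊕ Fin p)) (LB : Language (Fin b ⊕ Fin q)) :
    Language ((Fin a ⊕ Fin b) ⊕ (Fin p × Fin q)) :=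
  {w | ∃ (d : ℕ) (ws : Fin (d + 1) → List (Fin a)) (vs : Fin (d + 1) → List (Fin b))
      (g : Fin d → Fin p × Fin q),
    w = (List.ofFn fun l : Fin d =>
          (ws l.castSucc).map (fun x => Sum.inl (Sum.inl x)) ++
          (vs l.castSucc).map (fun x => Sum.inl (Sum.inr x)) ++ [Sum.inr (g l)]).flatten
        ++ (ws (Fin.last d)).map (fun x => Sum.inl (Sum.inl x))
        ++ (vs (Fin.last d)).map (fun x => Sum.inl (Sum.inr x)) ∧
    ((List.ofFn fun l : Fin d =>
        (ws l.castSucc).map Sum.inl ++ [Sum.inr (g l).1]).flatten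
      ++ (ws (Fin.last d)).map Sum.inl) ∈ LA ∧
    ((List.ofFn fun l : Fin d =>
        (vs l.castSucc).map Sum.inl ++ [Sum.inr (g l).2]).flatten
      ++ (vs (Fin.last d)).map Sum.inl) ∈ LB}

/-- `(L)_m^d`: the words of a language `L` over `Fin a ⊕ Fin p` with exactly `m`
occurrences of τ-letters (left letters) and `d` occurrences of non-τ letters
(right letters). -/
def sect {a p : ℕ} (L : Language (Fin a ⊕ Fin p)) (m d : ℕ) : Set (List (Fin a ⊕ Fin p)) :=
  {w | w ∈ L ∧ w.countP (fun x => x.isLeft) = m ∧ w.countP (fun x => x.isRight) = d}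

/-- `(L_A ⊠ L_B)_{m,n}^d`: the words of the Segre product with exactly `m` occurrences of
letters `τ_{1,·}`, `n` occurrences of letters `τ_{2,·}` and `d` occurrences of γ-letters. -/
def segreSect {a p b q : ℕ} (LA : Language (Fin a ⊕ Fin p)) (LB : Language (Fin b ⊕ Fin q))
    (m n d : ℕ) : Set (List ((Fin a ⊕ Fin b) ⊕ (Fin p × Fin q))) :=
  {w | w ∈ segreLang LA LB ∧
    w.countP (fun x => match x with | Sum.inl (Sum.inl _) => true | _ => false) = m ∧
    w.countP (fun x => match x with | Sum.inl (Sum.inr _) => true | _ => false) = n ∧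
    w.countP (fun x => match x with | Sum.inr _ => true | _ => false) = d}

/-- The word `w_1 γ_1 ⋯ w_d γ_d w_{d+1}` assembled from its blocks and separators. -/
def blockWord {α β : Type*} {d : ℕ} (ws : Fin (d + 1) → List α) (g : Fin d → β) :
    List (α ⊕ β) :=
  (List.ofFn fun l : Fin d => (ws l.castSucc).map Sum.inl ++ [Sum.inr (g l)]).flatten
    ++ (ws (Fin.last d)).map Sum.inl

/-- The word `w_1 v_1 γ_1 ⋯ w_d v_d γ_d w_{d+1} v_{d+1}`. -/
def segreWord {α β γ : Type*} {d : ℕ} (ws : Fin (d + 1) → List α) (vs : Fin (d + 1) → List β)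
    (g : Fin d → γ) : List ((α ⊕ β) ⊕ γ) :=
  (List.ofFn fun l : Fin d =>
      (ws l.castSucc).map (fun x => Sum.inl (Sum.inl x)) ++
      (vs l.castSucc).map (fun x => Sum.inl (Sum.inr x)) ++ [Sum.inr (g l)]).flatten
    ++ (ws (Fin.last d)).map (fun x => Sum.inl (Sum.inl x))
    ++ (vs (Fin.last d)).map (fun x => Sum.inl (Sum.inr x))

theorem blockWord_succ {α β : Type*} {d : ℕ} (ws : Fin (d + 2) → List α) (g : Fin (d + 1) → β) :
    blockWord ws g =
      (ws 0).map Sum.inl ++ Sum.inr (g 0) :: blockWord (Fin.tail ws) (Fin.tail g) := by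
  simp [blockWord, List.ofFn_succ, Fin.tail]

theorem segreWord_succ {α β γ : Type*} {d : ℕ} (ws : Fin (d + 2) → List α)
    (vs : Fin (d + 2) → List β) (g : Fin (d + 1) → γ) :
    segreWord ws vs g = (ws 0).map (fun x => Sum.inl (Sum.inl x)) ++
      ((vs 0).map (fun x => Sum.inl (Sum.inr x)) ++
        Sum.inr (g 0) :: segreWord (Fin.tail ws) (Fin.tail vs) (Fin.tail g)) := by
  simp [segreWord, List.ofFn_succ, Fin.tail]

theorem exists_eq_blockWord {α β : Type*} (u : List (α ⊕ β)) (d : ℕ)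
    (h : u.countP (fun x => x.isRight) = d) :
    ∃ (ws : Fin (d + 1) → List α) (g : Fin d → β), u = blockWord ws g := by
  induction u generalizing d with
  | nil =>
    obtain rfl : d = 0 := by simpa using h.symm
    exact ⟨fun _ => [], Fin.elim0, by simp [blockWord]⟩
  | cons c u ih =>
    rcases c with x | i
    · obtain ⟨ws, g, rfl⟩ := ih d (by simpa using h)
      refine ⟨Fin.cons (x :: ws 0) (Fin.tail ws), g, ?_⟩
      cases d with
      | zero => simp [blockWord]
      | succ d => simp [blockWord_succ]
    · cases d with
      | zero => simp at h
      | succ d =>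
        obtain ⟨ws, g, rfl⟩ := ih d (by simpa [List.countP_cons] using h)
        exact ⟨Fin.cons [] ws, Fin.cons i g, by simp [blockWord_succ]⟩

/-- Interleave two words, synchronising them at their right letters and putting the left letters
of the first word first. -/
def segreMerge {α β γ δ : Type*} : List (α ⊕ γ) → List (β ⊕ δ) → List ((α ⊕ β) ⊕ (γ × δ))
  | Sum.inl x :: u, v => Sum.inl (Sum.inl x) :: segreMerge u v
  | [], Sum.inl y :: v => Sum.inl (Sum.inr y) :: segreMerge [] v
  | Sum.inr i :: u, Sum.inl y :: v => Sum.inl (Sum.inr y) :: segreMerge (Sum.inr i :: u) v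
  | Sum.inr i :: u, Sum.inr j :: v => Sum.inr (i, j) :: segreMerge u v
  | [], [] => []
  | [], Sum.inr _ :: _ => []
  | Sum.inr _ :: _, [] => []
termination_by u v => u.length + v.length

theorem segreMerge_map_inl_append {α β γ δ : Type*} (w : List α) (u : List (α ⊕ γ))
    (v : List (β ⊕ δ)) :
    segreMerge (w.map Sum.inl ++ u) v =
      w.map (fun x => Sum.inl (Sum.inl x)) ++ segreMerge u v := by
  induction w with
  | nil => rfl
  | cons x w ih => simp [segreMerge, ih]

theorem segreMerge_inr_cons {α β γ δ : Type*} (i : γ) (j : δ) (w : List β) (u : List (α ⊕ γ))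
    (v : List (β ⊕ δ)) :
    segreMerge (Sum.inr i :: u) (w.map Sum.inl ++ Sum.inr j :: v) =
      w.map (fun x => Sum.inl (Sum.inr x)) ++ Sum.inr (i, j) :: segreMerge u v := by
  induction w with
  | nil => simp [segreMerge]
  | cons x w ih => simp [segreMerge, ih]

theorem segreMerge_nil_map_inl {α β γ δ : Type*} (w : List β) :
    segreMerge ([] : List (α ⊕ γ)) (w.map Sum.inl : List (β ⊕ δ)) =
      w.map (fun x => Sum.inl (Sum.inr x)) := by
  induction w with
  | nil => simp [segreMerge]
  | cons x w ih => simp [segreMerge, ih]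

theorem segreMerge_blockWord {α β γ δ : Type*} {d : ℕ} (ws : Fin (d + 1) → List α)
    (vs : Fin (d + 1) → List β) (g : Fin d → γ × δ) :
    segreMerge (blockWord ws fun l => (g l).1) (blockWord vs fun l => (g l).2) =
      segreWord ws vs g := by
  induction d with
  | zero =>
    have h := segreMerge_map_inl_append (ws 0) ([] : List (α ⊕ γ))
      ((vs 0).map Sum.inl : List (β ⊕ δ))
    rw [segreMerge_nil_map_inl, List.append_nil] at h
    simpa [blockWord, segreWord] using h
  | succ d ih =>
    rw [blockWord_succ, blockWord_succ, segreWord_succ, segreMerge_map_inl_append,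
      segreMerge_inr_cons, ← ih]
    rfl

/-- The first component of a letter of the Segre alphabet, if there is one. -/
def segreFst {α β γ δ : Type*} : (α ⊕ β) ⊕ (γ × δ) → Option (α ⊕ γ)
  | Sum.inl (Sum.inl x) => some (Sum.inl x)
  | Sum.inl (Sum.inr _) => none
  | Sum.inr c => some (Sum.inr c.1)

/-- The second component of a letter of the Segre alphabet, if there is one. -/
def segreSnd {α β γ δ : Type*} : (α ⊕ β) ⊕ (γ × δ) → Option (β ⊕ δ)
  | Sum.inl (Sum.inl _) => none
  | Sum.inl (Sum.inr y) => some (Sum.inl y)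
  | Sum.inr c => some (Sum.inr c.2)

theorem filterMap_segreFst_segreWord {α β γ δ : Type*} {d : ℕ} (ws : Fin (d + 1) → List α)
    (vs : Fin (d + 1) → List β) (g : Fin d → γ × δ) :
    (segreWord ws vs g).filterMap segreFst = blockWord ws fun l => (g l).1 := by
  induction d with
  | zero => simp [segreWord, blockWord, List.filterMap_map, Function.comp_def, segreFst]
  | succ d ih =>
    rw [segreWord_succ, blockWord_succ]
    simp [ih, List.filterMap_map, Function.comp_def, segreFst, Fin.tail_def]

theorem filterMap_segreSnd_segreWord {α β γ δ : Type*} {d : ℕ} (ws : Fin (d + 1) → List α)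
    (vs : Fin (d + 1) → List β) (g : Fin d → γ × δ) :
    (segreWord ws vs g).filterMap segreSnd = blockWord vs fun l => (g l).2 := by
  induction d with
  | zero => simp [segreWord, blockWord, List.filterMap_map, Function.comp_def, segreSnd]
  | succ d ih =>
    rw [segreWord_succ, blockWord_succ]
    simp [ih, List.filterMap_map, Function.comp_def, segreSnd, Fin.tail_def]

theorem mem_segreLang_iff {a p b q : ℕ} {LA : Language (Fin a ⊕ Fin p)}
    {LB : Language (Fin b ⊕ Fin q)} {w : List ((Fin a ⊕ Fin b) ⊕ (Fin p × Fin q))} :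
    w ∈ segreLang LA LB ↔ ∃ (d : ℕ) (ws : Fin (d + 1) → List (Fin a))
      (vs : Fin (d + 1) → List (Fin b)) (g : Fin d → Fin p × Fin q), w = segreWord ws vs g ∧
        (blockWord ws fun l => (g l).1) ∈ LA ∧ (blockWord vs fun l => (g l).2) ∈ LB :=
  Iff.rfl

theorem mem_segreSect_iff {a p b q : ℕ} {LA : Language (Fin a ⊕ Fin p)}
    {LB : Language (Fin b ⊕ Fin q)} {m n d : ℕ}
    {w : List ((Fin a ⊕ Fin b) ⊕ (Fin p × Fin q))} :
    w ∈ segreSect LA LB m n d ↔ w ∈ segreLang LA LB ∧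
      (w.filterMap segreFst).countP (fun x => x.isLeft) = m ∧
      (w.filterMap segreSnd).countP (fun x => x.isLeft) = n ∧
      (w.filterMap segreFst).countP (fun x => x.isRight) = d ∧
      (w.filterMap segreSnd).countP (fun x => x.isRight) = d := by
  have h : w.countP (fun x => match x with | Sum.inl (Sum.inl _) => true | _ => false) =
        (w.filterMap segreFst).countP (fun x => x.isLeft) ∧
      w.countP (fun x => match x with | Sum.inl (Sum.inr _) => true | _ => false) =
        (w.filterMap segreSnd).countP (fun x => x.isLeft) ∧
      w.countP (fun x => match x with | Sum.inr _ => true | _ => false) =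
        (w.filterMap segreFst).countP (fun x => x.isRight) ∧
      w.countP (fun x => match x with | Sum.inr _ => true | _ => false) =
        (w.filterMap segreSnd).countP (fun x => x.isRight) := by
    clear LA LB m n d
    induction w with
    | nil => simp
    | cons c w ih =>
      obtain ⟨h₁, h₂, h₃, h₄⟩ := ih
      rcases c with (x | y) | c <;>
        simp [segreFst, segreSnd, List.countP_cons, List.filterMap_cons, ← h₁, ← h₂, ← h₃, ← h₄]
  obtain ⟨h₁, h₂, h₃, h₄⟩ := h
  simp only [segreSect, Set.mem_ofPred_eq]
  rw [← h₁, ← h₂, ← h₃, ← h₄, and_self]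

theorem injOn_segreLang {a p b q : ℕ} (LA : Language (Fin a ⊕ Fin p))
    (LB : Language (Fin b ⊕ Fin q)) :
    Set.InjOn (fun w => (w.filterMap segreFst, w.filterMap segreSnd)) {w | w ∈ segreLang LA LB} := by
  refine Set.LeftInvOn.injOn (f₁' := fun u => segreMerge u.1 u.2) ?_
  intro w hw
  obtain ⟨d, ws, vs, g, rfl, -, -⟩ := mem_segreLang_iff.1 hw
  simp only [filterMap_segreFst_segreWord, filterMap_segreSnd_segreWord, segreMerge_blockWord]

theorem image_segreSect {a p b q : ℕ} (LA : Language (Fin a ⊕ Fin p))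
    (LB : Language (Fin b ⊕ Fin q)) (m n d : ℕ) :
    (fun w => (w.filterMap segreFst, w.filterMap segreSnd)) '' segreSect LA LB m n d =
      sect LA m d ×ˢ sect LB n d := by
  ext ⟨u, v⟩
  constructor
  · rintro ⟨w, hw, h⟩
    obtain ⟨rfl, rfl⟩ := Prod.mk.inj h
    obtain ⟨hL, hm, hn, hd, hd'⟩ := mem_segreSect_iff.1 hw
    obtain ⟨e, ws, vs, g, rfl, hA, hB⟩ := mem_segreLang_iff.1 hL
    exact ⟨⟨by rwa [filterMap_segreFst_segreWord], hm, hd⟩,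
      ⟨by rwa [filterMap_segreSnd_segreWord], hn, hd'⟩⟩
  · rintro ⟨⟨hA, hm, hd⟩, ⟨hB, hn, hd'⟩⟩
    dsimp only at hA hm hd hB hn hd'
    obtain ⟨ws, g, rfl⟩ := exists_eq_blockWord u d hd
    obtain ⟨vs, k, rfl⟩ := exists_eq_blockWord v d hd'
    have hfst := filterMap_segreFst_segreWord ws vs fun l => (g l, k l)
    have hsnd := filterMap_segreSnd_segreWord ws vs fun l => (g l, k l)
    refine ⟨segreWord ws vs fun l => (g l, k l), ?_, Prod.ext hfst hsnd⟩
    rw [mem_segreSect_iff, hfst, hsnd]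
    exact ⟨mem_segreLang_iff.2 ⟨d, ws, vs, _, rfl, hA, hB⟩, hm, hn, hd, hd'⟩

/-- `#(L_A ⊠ L_B)_{m,n}^d = #(L_A)_m^d · #(L_B)_n^d`. -/
theorem stmt2 {a p b q : ℕ} (LA : Language (Fin a ⊕ Fin p)) (LB : Language (Fin b ⊕ Fin q))
    (m n d : ℕ) :
    (segreSect LA LB m n d).ncard = (sect LA m d).ncard * (sect LB n d).ncard := by
  rw [← Set.ncard_prod, ← image_segreSect, Set.InjOn.ncard_image]
  exact (injOn_segreLang LA LB).mono fun w hw => hw.1
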